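/- Eigenvectors of the Bernstein mass matrix: let d ≥ 1, N ≥ 0, and 0 ≤ i ≤ N. Suppose p : ℝ^d → ℝ is a polynomial function of total degree at most i satisfying ∫_{T_d} p(x) q(x) dx = 0 for every polynomial q of total degree at most i−1, and suppose c is a vector indexed by multi-indices of weight N such that p(x) = Σ_{|α|=N} c_α b^N_α(x) for all x ∈ ℝ^d. Then M^N c = λ^N_i · c, where λ^N_i := (N!)² / ((N+i+d)! · (N−i)!). -/

import Mathlib

open MeasureTheory

/-- The unit `n`-simplex `T_n = {x ∈ ℝ^n : x_i ≥ 0, Σ x_i ≤ 1}`. -/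
def unitSimplex (n : ℕ) : Set (Fin n → ℝ) := {x | (∀ i, 0 ≤ x i) ∧ ∑ i, x i ≤ 1}

/-- Barycentric coordinates `λ(x) = (x_1, …, x_n, 1 − Σ_i x_i)` of `x ∈ ℝ^n`. -/
noncomputable def bary (n : ℕ) (x : Fin n → ℝ) : Fin (n + 1) → ℝ :=
  Fin.snoc x (1 - ∑ i, x i)

/-- The Bernstein basis function `b^N_α(x) = (N!/∏_j α_j!) · ∏_j λ(x)_j^{α_j}` on `ℝ^n`,
for a multi-index `α : Fin (n+1) → ℕ`. -/
noncomputable def bernFn (n N : ℕ) (α : Fin (n + 1) → ℕ) (x : Fin n → ℝ) : ℝ :=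
  ((N.factorial : ℝ) / ∏ j, ((α j).factorial : ℝ)) * ∏ j, bary n x j ^ α j

instance multiIndexFintype (n N : ℕ) : Fintype {α : Fin n → ℕ // ∑ j, α j = N} :=
  Fintype.ofFinset (Finset.Nat.antidiagonalTuple n N) fun x => by
    simp [Finset.Nat.mem_antidiagonalTuple]; rfl

/-- The degree-`N` Bernstein mass matrix `M^N` on the unit `d`-simplex, indexed by
multi-indices of weight `N`, with entries `M^N_{α,β} = ∫_{T_d} b^N_α b^N_β dx`. -/
noncomputable def massMatrix (d N : ℕ) :
    Matrix {α : Fin (d + 1) → ℕ // ∑ j, α j = N}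
           {α : Fin (d + 1) → ℕ // ∑ j, α j = N} ℝ :=
  fun α β => ∫ x in unitSimplex d, bernFn d N α.1 x * bernFn d N β.1 x

/-- scaled simplex -/
def scSimplex (d : ℕ) (t : ℝ) : Set (Fin d → ℝ) := {x | (∀ i, 0 ≤ x i) ∧ ∑ i, x i ≤ t}

lemma beta_nat (a : ℕ) : ∀ (b : ℕ) (t : ℝ), ∫ x in (0:ℝ)..t, x ^ a * (t - x) ^ b
    = (a.factorial : ℝ) * b.factorial / (a + b + 1).factorial * t ^ (a + b + 1) := by
  induction a with
  | zero =>
    intro b t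
    have h := intervalIntegral.integral_comp_sub_left (a := 0) (b := t) (fun x : ℝ => x ^ b) t
    simp only [pow_zero, one_mul]
    rw [h, sub_self, sub_zero, integral_pow]
    have : (b.factorial : ℝ) ≠ 0 := by positivity
    simp [Nat.factorial_succ]
    field_simp
  | succ a ih =>
    intro b t
    have hd : ∀ x ∈ Set.uIcc (0:ℝ) t, HasDerivAt (fun x : ℝ => x ^ (a + 1) * (t - x) ^ (b + 1))
        ((a + 1) * (x ^ a * (t - x) ^ (b + 1)) - (b + 1) * (x ^ (a + 1) * (t - x) ^ b)) x := by
      intro x _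
      have h1 := hasDerivAt_pow (a + 1) x
      have h2 := ((hasDerivAt_id x).const_sub t).pow (b + 1)
      convert! h1.mul h2 using 1
      simp
      ring
    have h := intervalIntegral.integral_eq_sub_of_hasDerivAt hd
      (Continuous.intervalIntegrable (by fun_prop) _ _)
    rw [intervalIntegral.integral_sub (Continuous.intervalIntegrable (by fun_prop) _ _)
      (Continuous.intervalIntegrable (by fun_prop) _ _),
      intervalIntegral.integral_const_mul, intervalIntegral.integral_const_mul, ih] at h
    simp at h
    have hb : (b + 1 : ℝ) ≠ 0 := by positivity
    apply mul_left_cancel₀ hb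
    have e : a + 1 + b + 1 = a + (b + 1) + 1 := by ring
    rw [e]
    rw [sub_eq_zero] at h
    rw [← h]
    simp only [Nat.factorial_succ a, Nat.factorial_succ b]
    push_cast
    ring

lemma isClosed_scSimplex (d : ℕ) (t : ℝ) : IsClosed (scSimplex d t) := by
  unfold scSimplex
  apply IsClosed.inter
  · have : {a : Fin d → ℝ | ∀ i, 0 ≤ a i} = ⋂ i, {a | 0 ≤ a i} := by ext; simp
    change IsClosed {a : Fin d → ℝ | ∀ i, 0 ≤ a i}
    rw [this]
    exact isClosed_iInter fun i => isClosed_le continuous_const (continuous_apply i)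
  · exact isClosed_le (f := fun a : Fin d → ℝ => ∑ i, a i) (by fun_prop) continuous_const

lemma isCompact_scSimplex (d : ℕ) (t : ℝ) : IsCompact (scSimplex d t) := by
  apply IsCompact.of_isClosed_subset (isCompact_Icc (a := (fun _ => 0 : Fin d → ℝ))
    (b := fun _ => t)) (isClosed_scSimplex d t)
  intro x hx
  refine ⟨fun i => hx.1 i, fun i => ?_⟩
  exact (Finset.single_le_sum (fun j _ => hx.1 j) (Finset.mem_univ i)).trans hx.2

lemma dirichlet (d : ℕ) : ∀ (a : Fin d → ℕ) (m : ℕ) (t : ℝ), 0 ≤ t →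
    ∫ x in scSimplex d t, (∏ i, x i ^ a i) * (t - ∑ i, x i) ^ m
    = (∏ i, ((a i).factorial : ℝ)) * m.factorial / (∑ i, a i + m + d).factorial
      * t ^ (∑ i, a i + m + d) := by
  induction d with
  | zero =>
    intro a m t ht
    have : scSimplex 0 t = Set.univ := by
      ext x; simp [scSimplex, ht]
    have hm : (m.factorial : ℝ) ≠ 0 := by positivity
    rw [this, Measure.restrict_univ, Measure.volume_pi_eq_dirac (0 : Fin 0 → ℝ), integral_dirac]
    simp [hm]
  | succ d ih =>
    intro a m t ht
    set f : (Fin (d+1) → ℝ) → ℝ := fun x => (∏ i, x i ^ a i) * (t - ∑ i, x i) ^ m with hf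
    have hfc : Continuous f := by fun_prop
    have hint : IntegrableOn f (scSimplex (d+1) t) :=
      hfc.continuousOn.integrableOn_compact (isCompact_scSimplex _ _)
    have hms : MeasurableSet (scSimplex (d+1) t) := (isClosed_scSimplex _ _).measurableSet
    have mp := (volume_preserving_piFinSuccAbove (fun _ : Fin (d + 1) => ℝ) 0).symm
    rw [← integral_indicator hms]
    rw [← integrable_indicator_iff hms] at hint
    rw [← mp.integral_comp (MeasurableEquiv.measurableEmbedding _)]
    have hint2 := (mp.integrable_comp_emb (MeasurableEquiv.measurableEmbedding _)).2 hint
    change Integrable _ (volume.prod volume) at hint2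
    change ∫ y, _ ∂(volume.prod volume) = _
    refine (integral_prod _ hint2).trans ?_
    simp only [Function.comp_apply]
    have key : ∀ z : ℝ, (∫ y : Fin d → ℝ, (scSimplex (d+1) t).indicator f
        ((MeasurableEquiv.piFinSuccAbove (fun _ : Fin (d + 1) => ℝ) 0).symm (z, y)))
        = (Set.Icc 0 t).indicator (fun z => 
          ((∏ i, ((a (Fin.succ i)).factorial : ℝ)) * m.factorial / (∑ i, a (Fin.succ i) + m + d).factorial)
          * (z ^ a 0 * (t - z) ^ (∑ i, a (Fin.succ i) + m + d))) z := by
      intro z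
      by_cases hz : z ∈ Set.Icc 0 t
      · rw [Set.indicator_of_mem hz]
        have h1 := ih (fun i => a i.succ) m (t - z) (by linarith [hz.2])
        rw [← integral_indicator (isClosed_scSimplex _ _).measurableSet] at h1
        rw [mul_left_comm, ← h1, ← integral_const_mul]
        congr 1
        ext y
        have hmem : (MeasurableEquiv.piFinSuccAbove (fun _ : Fin (d + 1) => ℝ) 0).symm (z, y)
            ∈ scSimplex (d+1) t ↔ y ∈ scSimplex d (t - z) := by
          simp [scSimplex, Fin.forall_fin_succ, Fin.sum_univ_succ, MeasurableEquiv.piFinSuccAbove]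
          constructor
          · rintro ⟨⟨_, h'⟩, h⟩; exact ⟨h', by linarith⟩
          · rintro ⟨h', h⟩; exact ⟨⟨hz.1, h'⟩, by linarith⟩
        by_cases hy : y ∈ scSimplex d (t - z)
        · rw [Set.indicator_of_mem hy, Set.indicator_of_mem (hmem.2 hy)]
          simp [hf, Fin.sum_univ_succ, Fin.prod_univ_succ, MeasurableEquiv.piFinSuccAbove]
          ring
        · rw [Set.indicator_of_notMem hy, Set.indicator_of_notMem (fun h => hy (hmem.1 h)), mul_zero]
      · rw [Set.indicator_of_notMem hz]
        rw [integral_eq_zero_of_ae]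
        refine Filter.Eventually.of_forall fun y => ?_
        apply Set.indicator_of_notMem
        intro h
        apply hz
        simp [scSimplex, Fin.forall_fin_succ, Fin.sum_univ_succ, MeasurableEquiv.piFinSuccAbove] at h
        exact ⟨h.1.1, by linarith [Finset.sum_nonneg (fun i (_ : i ∈ Finset.univ) => h.1.2 i)]⟩
    simp_rw [key]
    rw [integral_indicator measurableSet_Icc, integral_const_mul, integral_Icc_eq_integral_Ioc,
      ← intervalIntegral.integral_of_le ht, beta_nat]
    have e : ∑ i, a i + m + (d + 1) = a 0 + (∑ i : Fin d, a i.succ + m + d) + 1 := by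
      rw [Fin.sum_univ_succ]; ring
    rw [e, Fin.prod_univ_succ]
    have h1 : ((∑ i : Fin d, a i.succ + m + d).factorial : ℝ) ≠ 0 := by positivity
    field_simp

/-- coefficients of the rising factorial in terms of falling factorials -/
noncomputable def riseCoef (b k : ℕ) : ℝ := (b.choose k : ℝ) * (b.factorial / k.factorial)

lemma rise_eq (a b : ℕ) : ((b + a).factorial : ℝ) / a.factorial
    = ∑ k ∈ Finset.range (b + 1), riseCoef b k * (a.descFactorial k : ℝ) := by
  have h := Nat.add_choose_eq a b b
  rw [Finset.Nat.sum_antidiagonal_eq_sum_range_succ_mk] at h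
  have h2 : ((a + b).choose b : ℝ) = ∑ k ∈ Finset.range (b + 1), (a.choose k : ℝ) * b.choose k := by
    rw [h]; push_cast
    refine Finset.sum_congr rfl fun k hk => ?_
    rw [Nat.choose_symm (by simpa [Nat.lt_succ_iff] using hk)]
  have h3 := Nat.add_choose_mul_factorial_mul_factorial a b
  have h4 : ((a + b).choose b : ℝ) * a.factorial * b.factorial = (a + b).factorial := by
    exact_mod_cast h3
  have ha : (a.factorial : ℝ) ≠ 0 := by positivity
  rw [add_comm b a, ← h4, h2]
  rw [mul_right_comm, mul_div_assoc, div_self ha, mul_one, Finset.sum_mul]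
  refine Finset.sum_congr rfl fun k hk => ?_
  rw [riseCoef, Nat.descFactorial_eq_factorial_mul_choose]
  have hk : (k.factorial : ℝ) ≠ 0 := by positivity
  push_cast
  field_simp

lemma sum_desc {n : ℕ} (N : ℕ) (γ : Fin n → ℕ) (y : Fin n → ℝ) :
    ∑ α : {α : Fin n → ℕ // ∑ j, α j = N}, (∏ j, ((α.1 j).descFactorial (γ j) : ℝ)) *
      (((N.factorial : ℝ) / ∏ j, ((α.1 j).factorial : ℝ)) * ∏ j, y j ^ α.1 j)
    = (N.descFactorial (∑ j, γ j) : ℝ) * ((∏ j, y j ^ γ j) * (∑ j, y j) ^ (N - ∑ j, γ j)) := by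
  rw [← Finset.sum_subtype (Finset.piAntidiag Finset.univ N)
    (f := fun α : Fin n → ℕ => (∏ j, ((α j).descFactorial (γ j) : ℝ)) *
      (((N.factorial : ℝ) / ∏ j, ((α j).factorial : ℝ)) * ∏ j, y j ^ α j))
    (by intro x; simp [Finset.mem_piAntidiag])]
  by_cases hG : ∑ j, γ j ≤ N
  · rw [Finset.sum_pow_eq_sum_piAntidiag, Finset.mul_sum, Finset.mul_sum]
    symm
    apply Finset.sum_of_injOn (fun δ => δ + γ)
    · intro a _ b _ h; exact add_right_cancel h
    · intro δ hδ
      simp [Finset.mem_piAntidiag, Finset.sum_add_distrib] at hδ ⊢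
      have hδ' : ∑ j, δ j = N - ∑ j, γ j := hδ
      omega
    · intro α hα hn
      have : ∃ j, α j < γ j := by
        by_contra! hcon
        apply hn
        refine ⟨α - γ, ?_, ?_⟩
        · simp [Finset.mem_piAntidiag] at hα ⊢
          rw [← hα, Finset.sum_tsub_distrib _ (fun j _ => hcon j)]
        · ext j; simp [hcon j]
      obtain ⟨j, hj⟩ := this
      rw [Finset.prod_eq_zero (Finset.mem_univ j), zero_mul]
      simp [Nat.descFactorial_of_lt hj]
    · intro δ hδ
      simp [Finset.mem_piAntidiag] at hδ
      have h1 : ((∏ j, (δ j).factorial : ℕ) : ℝ) * Nat.multinomial Finset.univ δ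
          = (N - ∑ j, γ j).factorial := by
        rw [← hδ]; exact_mod_cast Nat.multinomial_spec Finset.univ δ
      have h2 : ((N - ∑ j, γ j).factorial : ℝ) * N.descFactorial (∑ j, γ j) = N.factorial := by
        exact_mod_cast Nat.factorial_mul_descFactorial hG
      have h3 : (∏ j, ((δ j).factorial : ℝ)) * ∏ j, ((δ j + γ j).descFactorial (γ j) : ℝ)
          = ∏ j, ((δ j + γ j).factorial : ℝ) := by
        rw [← Finset.prod_mul_distrib]
        refine Finset.prod_congr rfl fun j _ => ?_
        have := Nat.factorial_mul_descFactorial (Nat.le_add_left (γ j) (δ j))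
        rw [Nat.add_sub_cancel] at this
        exact_mod_cast this
      push_cast at h1
      have p1 : (∏ j, ((δ j).factorial : ℝ)) ≠ 0 := by positivity
      have p2 : (∏ j, ((δ j + γ j).factorial : ℝ)) ≠ 0 := by positivity
      simp only [Pi.add_apply, pow_add, Finset.prod_mul_distrib]
      have key : (N.descFactorial (∑ j, γ j) : ℝ) * Nat.multinomial Finset.univ δ
        = (∏ j, ((δ j + γ j).descFactorial (γ j) : ℝ)) * (N.factorial / ∏ j, ((δ j + γ j).factorial : ℝ)) := by
        rw [← mul_div_assoc, eq_div_iff p2, ← h3, ← h2, ← h1]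
        ring
      linear_combination (∏ j, y j ^ δ j) * (∏ j, y j ^ γ j) * key
  · rw [Nat.descFactorial_of_lt (by omega)]
    simp only [Nat.cast_zero, zero_mul]
    refine Finset.sum_eq_zero fun α hα => ?_
    have : ∃ j, α j < γ j := by
      by_contra! hcon
      simp [Finset.mem_piAntidiag] at hα
      exact hG (hα ▸ Finset.sum_le_sum fun j _ => hcon j)
    obtain ⟨j, hj⟩ := this
    rw [Finset.prod_eq_zero (Finset.mem_univ j), zero_mul]
    simp [Nat.descFactorial_of_lt hj]

lemma unitSimplex_eq (d : ℕ) : unitSimplex d = scSimplex d 1 := rfl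

lemma poly_cont {d : ℕ} (P : MvPolynomial (Fin d) ℝ) :
    Continuous (fun x => MvPolynomial.eval x P) := MvPolynomial.continuous_eval P

lemma int_cont {d : ℕ} {f : (Fin d → ℝ) → ℝ} (hf : Continuous f) :
    IntegrableOn f (unitSimplex d) :=
  hf.continuousOn.integrableOn_compact (isCompact_scSimplex d 1)

/-- Bernstein polynomial as a formal polynomial -/
noncomputable def bernPoly (d N : ℕ) (α : Fin (d + 1) → ℕ) : MvPolynomial (Fin d) ℝ :=
  MvPolynomial.C ((N.factorial : ℝ) / ∏ j, ((α j).factorial : ℝ)) *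
    ((∏ j : Fin d, MvPolynomial.X j ^ α j.castSucc) *
      (1 - ∑ j, MvPolynomial.X j) ^ α (Fin.last d))

lemma eval_bernPoly (d N : ℕ) (α : Fin (d + 1) → ℕ) (x : Fin d → ℝ) :
    MvPolynomial.eval x (bernPoly d N α) = bernFn d N α x := by
  simp [bernPoly, bernFn, bary, Fin.prod_univ_castSucc]

/-- the `L²` pairing -/
noncomputable def ipl {d : ℕ} (Q : MvPolynomial (Fin d) ℝ) : MvPolynomial (Fin d) ℝ →ₗ[ℝ] ℝ where
  toFun P := ∫ x in unitSimplex d, MvPolynomial.eval x P * MvPolynomial.eval x Q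
  map_add' P R := by
    simp only [map_add, add_mul]
    exact integral_add (int_cont ((poly_cont _).mul (poly_cont _)))
      (int_cont ((poly_cont _).mul (poly_cont _)))
  map_smul' c P := by
    simp only [MvPolynomial.smul_eval, mul_assoc, RingHom.id_apply, smul_eq_mul]
    exact integral_const_mul _ _

lemma ipl_def {d : ℕ} (Q P : MvPolynomial (Fin d) ℝ) :
    ipl Q P = ∫ x in unitSimplex d, MvPolynomial.eval x P * MvPolynomial.eval x Q := rfl

lemma ipl_comm {d : ℕ} (Q P : MvPolynomial (Fin d) ℝ) : ipl Q P = ipl P Q := by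
  simp only [ipl_def, mul_comm]

/-- the Bernstein-Durrmeyer operator -/
noncomputable def durr (d N : ℕ) : MvPolynomial (Fin d) ℝ →ₗ[ℝ] MvPolynomial (Fin d) ℝ :=
  ∑ α : {α : Fin (d + 1) → ℕ // ∑ j, α j = N},
    (ipl (bernPoly d N α.1)).smulRight (bernPoly d N α.1)

lemma durr_apply (d N : ℕ) (P : MvPolynomial (Fin d) ℝ) :
    durr d N P = ∑ α : {α : Fin (d + 1) → ℕ // ∑ j, α j = N},
      ipl (bernPoly d N α.1) P • bernPoly d N α.1 := by
  simp [durr]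

lemma durr_adj (d N : ℕ) (P Q : MvPolynomial (Fin d) ℝ) :
    ipl Q (durr d N P) = ipl P (durr d N Q) := by
  simp only [durr_apply, map_sum, map_smul, smul_eq_mul]
  refine Finset.sum_congr rfl fun α _ => ?_
  rw [ipl_comm Q, ipl_comm P, mul_comm]

lemma moment (d N : ℕ) (α : Fin (d + 1) → ℕ) (hα : ∑ j, α j = N) (β : Fin d →₀ ℕ) :
    ipl (bernPoly d N α) (MvPolynomial.monomial β 1)
    = (N.factorial : ℝ) / (N + ∑ j, β j + d).factorial *
      ∏ j : Fin d, (((β j + α j.castSucc).factorial : ℝ) / (α j.castSucc).factorial) := by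
  have h := dirichlet d (fun j => β j + α j.castSucc) (α (Fin.last d)) 1 zero_le_one
  have e : ∑ j : Fin d, (β j + α j.castSucc) + α (Fin.last d) + d = N + ∑ j, β j + d := by
    rw [← hα, Fin.sum_univ_castSucc, Finset.sum_add_distrib]; ring
  rw [e, one_pow, mul_one] at h
  have h0 : ipl (bernPoly d N α) (MvPolynomial.monomial β 1) =
    ∫ x in scSimplex d 1, ((N.factorial : ℝ) / ∏ j, ((α j).factorial : ℝ)) *
      ((∏ i, x i ^ (β i + α i.castSucc)) * (1 - ∑ i, x i) ^ α (Fin.last d)) := by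
    rw [ipl_def, unitSimplex_eq]
    congr 1
    ext x
    simp only [pow_add, Finset.prod_mul_distrib]
    simp [bernPoly, MvPolynomial.eval_monomial, Finsupp.prod_fintype]
    ring
  rw [h0, integral_const_mul, h, Fin.prod_univ_castSucc, Finset.prod_div_distrib]
  have p1 : ((α (Fin.last d)).factorial : ℝ) ≠ 0 := by positivity
  have p2 : (∏ j : Fin d, ((α j.castSucc).factorial : ℝ)) ≠ 0 := by positivity
  field_simp

lemma sum_desc_bern (d N : ℕ) (γ : Fin d → ℕ) (x : Fin d → ℝ) :
    ∑ α : {α : Fin (d + 1) → ℕ // ∑ j, α j = N},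
      (∏ j : Fin d, ((α.1 j.castSucc).descFactorial (γ j) : ℝ)) * bernFn d N α.1 x
    = (N.descFactorial (∑ j, γ j) : ℝ) * ∏ j, x j ^ γ j := by
  have h := sum_desc N (Fin.snoc γ 0 : Fin (d + 1) → ℕ) (bary d x)
  have hb : ∑ j, bary d x j = 1 := by simp [bary, Fin.sum_univ_castSucc]
  rw [hb, one_pow, mul_one] at h
  simp only [Fin.prod_univ_castSucc (fun j => (((_ : Fin (d + 1) → ℕ) j).descFactorial _ : ℝ))] at h
  convert h using 1
  · refine Finset.sum_congr rfl fun α _ => ?_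
    simp [bernFn]
  · simp [bary, Fin.prod_univ_castSucc, Fin.sum_univ_castSucc]

lemma durr_monomial (d N : ℕ) (β : Fin d →₀ ℕ) :
    durr d N (MvPolynomial.monomial β 1) =
    ((N.factorial : ℝ) / (N + ∑ j, β j + d).factorial) •
      ∑ γ ∈ Fintype.piFinset (fun j => Finset.range (β j + 1)),
        ((∏ j, riseCoef (β j) (γ j)) * (N.descFactorial (∑ j, γ j) : ℝ)) •
          MvPolynomial.monomial (Finsupp.equivFunOnFinite.symm γ) (1 : ℝ) := by
  apply MvPolynomial.funext
  intro x
  rw [durr_apply]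
  simp only [map_sum, MvPolynomial.smul_eval, eval_bernPoly]
  have h1 : ∀ α : {α : Fin (d + 1) → ℕ // ∑ j, α j = N},
      ipl (bernPoly d N α.1) (MvPolynomial.monomial β 1) * bernFn d N α.1 x
      = ((N.factorial : ℝ) / (N + ∑ j, β j + d).factorial) *
        ∑ γ ∈ Fintype.piFinset (fun j => Finset.range (β j + 1)),
          (∏ j, riseCoef (β j) (γ j)) *
            ((∏ j : Fin d, ((α.1 j.castSucc).descFactorial (γ j) : ℝ)) * bernFn d N α.1 x) := by
    intro α
    rw [moment d N α.1 α.2]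
    simp_rw [rise_eq]
    rw [Finset.prod_univ_sum, mul_assoc, Finset.sum_mul]
    simp only [Finset.prod_mul_distrib, mul_assoc]
  simp_rw [h1]
  rw [← Finset.mul_sum, Finset.sum_comm]
  congr 1
  refine Finset.sum_congr rfl fun γ _ => ?_
  rw [← Finset.mul_sum, sum_desc_bern, mul_assoc]
  simp [MvPolynomial.eval_monomial, Finsupp.prod_fintype]

/-- polynomials of degree less than `i` -/
noncomputable def lowDeg (d i : ℕ) : Submodule ℝ (MvPolynomial (Fin d) ℝ) :=
  Submodule.span ℝ {P | ∃ γ : Fin d →₀ ℕ, ∑ j, γ j < i ∧ P = MvPolynomial.monomial γ 1}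

lemma mono_mem {d i : ℕ} (γ : Fin d →₀ ℕ) (h : ∑ j, γ j < i) :
    MvPolynomial.monomial γ (1 : ℝ) ∈ lowDeg d i :=
  Submodule.subset_span ⟨γ, h, rfl⟩

lemma durr_low {d N i : ℕ} {R : MvPolynomial (Fin d) ℝ} (hR : R ∈ lowDeg d i) :
    durr d N R ∈ lowDeg d i := by
  induction hR using Submodule.span_induction with
  | mem x hx =>
    obtain ⟨β, hβ, rfl⟩ := hx
    rw [durr_monomial]
    refine Submodule.smul_mem _ _ (Submodule.sum_mem _ fun γ hγ => Submodule.smul_mem _ _ ?_)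
    apply mono_mem
    simp only [Fintype.mem_piFinset, Finset.mem_range, Nat.lt_succ_iff] at hγ
    exact lt_of_le_of_lt (Finset.sum_le_sum fun j _ => by simpa using hγ j) hβ
  | zero => simp
  | add x y _ _ hx hy => rw [map_add]; exact Submodule.add_mem _ hx hy
  | smul a x _ hx => rw [map_smul]; exact Submodule.smul_mem _ _ hx

/-- the eigenvalue -/
noncomputable def lam (d N i : ℕ) : ℝ := (N.factorial : ℝ) ^ 2
          / (((N + i + d).factorial : ℝ) * ((N - i).factorial : ℝ))

lemma durr_lead_mono {d N i : ℕ} (hi : i ≤ N) (β : Fin d →₀ ℕ) (hβ : ∑ j, β j ≤ i) :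
    durr d N (MvPolynomial.monomial β 1) - lam d N i • MvPolynomial.monomial β 1
      ∈ lowDeg d i := by
  rcases lt_or_eq_of_le hβ with h | h
  · exact Submodule.sub_mem _ (durr_low (mono_mem β h)) (Submodule.smul_mem _ _ (mono_mem β h))
  · rw [durr_monomial]
    have hmem : (β : Fin d → ℕ) ∈ Fintype.piFinset (fun j => Finset.range (β j + 1)) := by
      simp [Fintype.mem_piFinset]
    rw [← Finset.add_sum_erase _ _ hmem]
    have hc : ∀ b, riseCoef b b = 1 := by
      intro b
      have : (b.factorial : ℝ) ≠ 0 := by positivity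
      simp [riseCoef, this]
    have hl : (N.factorial : ℝ) / (N + i + d).factorial * (N.descFactorial i : ℝ) = lam d N i := by
      have h2 : ((N - i).factorial : ℝ) * N.descFactorial i = N.factorial := by
        exact_mod_cast Nat.factorial_mul_descFactorial hi
      have p1 : ((N - i).factorial : ℝ) ≠ 0 := by positivity
      have p2 : ((N + i + d).factorial : ℝ) ≠ 0 := by positivity
      rw [lam]
      field_simp
      rw [← h2]; ring
    have he : (Finsupp.equivFunOnFinite.symm (β : Fin d → ℕ)) = β := by ext; simp
    rw [smul_add, h, smul_smul, he]
    simp only [hc, Finset.prod_const_one, one_mul]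
    rw [hl, add_sub_cancel_left]
    refine Submodule.smul_mem _ _ (Submodule.sum_mem _ fun γ hγ => Submodule.smul_mem _ _ ?_)
    apply mono_mem
    simp only [Fintype.mem_piFinset, Finset.mem_range, Nat.lt_succ_iff, Finset.mem_erase] at hγ
    have hex : ∃ j, γ j ≠ β j := by
      by_contra! hcon
      exact hγ.1 (funext hcon)
    obtain ⟨j, hj⟩ := hex
    rw [← h]
    exact Finset.sum_lt_sum (fun j _ => by simpa using hγ.2 j)
      ⟨j, Finset.mem_univ j, by simpa using lt_of_le_of_ne (hγ.2 j) hj⟩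

lemma durr_lead {d N i : ℕ} (hi : i ≤ N) (P : MvPolynomial (Fin d) ℝ) (hP : P.totalDegree ≤ i) :
    durr d N P - lam d N i • P ∈ lowDeg d i := by
  have hs : P = ∑ β ∈ P.support, P.coeff β • MvPolynomial.monomial β (1 : ℝ) := by
    conv_lhs => rw [P.as_sum]
    refine Finset.sum_congr rfl fun β _ => ?_
    rw [MvPolynomial.smul_monomial, smul_eq_mul, mul_one]
  have h : durr d N P - lam d N i • P = ∑ β ∈ P.support, P.coeff β •
      (durr d N (MvPolynomial.monomial β 1) - lam d N i • MvPolynomial.monomial β 1) := by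
    conv_lhs => rw [hs]
    rw [map_sum, Finset.smul_sum, ← Finset.sum_sub_distrib]
    refine Finset.sum_congr rfl fun β _ => ?_
    rw [map_smul, smul_sub, smul_comm]
  rw [h]
  refine Submodule.sum_mem _ fun β hβ => Submodule.smul_mem _ _ (durr_lead_mono hi β ?_)
  have := (MvPolynomial.le_totalDegree hβ).trans hP
  rwa [Finsupp.sum_fintype _ _ (fun _ => rfl)] at this

lemma ipl_low {d i : ℕ} (P : MvPolynomial (Fin d) ℝ)
    (h : ∀ q : MvPolynomial (Fin d) ℝ, q.totalDegree < i → ipl P q = 0)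
    {R : MvPolynomial (Fin d) ℝ} (hR : R ∈ lowDeg d i) : ipl P R = 0 := by
  induction hR using Submodule.span_induction with
  | mem x hx =>
    obtain ⟨β, hβ, rfl⟩ := hx
    apply h
    rw [MvPolynomial.totalDegree_monomial _ one_ne_zero, Finsupp.sum_fintype _ _ (fun _ => rfl)]
    exact hβ
  | zero => simp
  | add x y _ _ hx hy => rw [map_add, hx, hy, add_zero]
  | smul a x _ hx => rw [map_smul, hx, smul_zero]

lemma eq_zero_of_ipl_self {d : ℕ} (P : MvPolynomial (Fin d) ℝ) (h : ipl P P = 0)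
    (x : Fin d → ℝ) (hx : ∀ j, 0 < x j) (hx1 : ∑ j, x j < 1) : MvPolynomial.eval x P = 0 := by
  rw [ipl_def] at h
  have hc : Continuous fun x => MvPolynomial.eval x P * MvPolynomial.eval x P :=
    (poly_cont _).mul (poly_cont _)
  rw [setIntegral_eq_zero_iff_of_nonneg_ae
    (Filter.Eventually.of_forall fun x => mul_self_nonneg _) (int_cont hc)] at h
  set U : Set (Fin d → ℝ) := {x | (∀ j, 0 < x j) ∧ ∑ j, x j < 1} with hU
  have hUT : U ⊆ unitSimplex d := fun x hx => ⟨fun j => (hx.1 j).le, hx.2.le⟩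
  have hUo : IsOpen U := by
    apply IsOpen.inter
    · change IsOpen {a : Fin d → ℝ | ∀ i, 0 < a i}
      have : {a : Fin d → ℝ | ∀ i, 0 < a i} = ⋂ i, {a | 0 < a i} := by ext; simp
      rw [this]
      exact isOpen_iInter_of_finite fun i => isOpen_lt continuous_const (continuous_apply i)
    · exact isOpen_lt (f := fun a : Fin d → ℝ => ∑ i, a i) (by fun_prop) continuous_const
  have := Measure.eqOn_open_of_ae_eq (ae_restrict_of_ae_restrict_of_subset hUT h) hUo
    hc.continuousOn continuousOn_const (show x ∈ U from ⟨hx, hx1⟩)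
  simpa using this

lemma bern_indep {d N : ℕ} (e : {α : Fin (d + 1) → ℕ // ∑ j, α j = N} → ℝ)
    (h : ∀ x : Fin d → ℝ, (∀ j, 0 < x j) → ∑ j, x j < 1 → ∑ α, e α * bernFn d N α.1 x = 0) :
    e = 0 := by
  set Q : MvPolynomial (Fin (d + 1)) ℝ :=
    ∑ α : {α : Fin (d + 1) → ℕ // ∑ j, α j = N}, MvPolynomial.monomial
      (Finsupp.equivFunOnFinite.symm α.1)
      (e α * ((N.factorial : ℝ) / ∏ j, ((α.1 j).factorial : ℝ))) with hQ
  have hQ0 : Q = 0 := by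
    apply MvPolynomial.funext_set (fun _ => Set.Ioi (0 : ℝ)) (fun _ => Set.Ioi_infinite 0)
    intro y hy
    have hy' : ∀ j, 0 < y j := fun j => hy j (Set.mem_univ j)
    set s := ∑ j, y j with hs
    have hs0 : 0 < s := Finset.sum_pos (fun j _ => hy' j) Finset.univ_nonempty
    have hsum : s = ∑ j : Fin d, y j.castSucc + y (Fin.last d) := Fin.sum_univ_castSucc _
    have h1 := h (fun j => y j.castSucc / s) (fun j => div_pos (hy' _) hs0)
      (by rw [← Finset.sum_div, div_lt_one hs0, hsum]; linarith [hy' (Fin.last d)])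
    have hb : ∀ j, y j = s * bary d (fun j => y j.castSucc / s) j := by
      intro j
      refine Fin.lastCases ?_ (fun j => ?_) j
      · simp only [bary, Fin.snoc_last]
        rw [← Finset.sum_div, mul_sub, mul_one, mul_div_cancel₀ _ hs0.ne']
        linarith
      · simp only [bary, Fin.snoc_castSucc]
        rw [mul_div_cancel₀ _ hs0.ne']
    have h2 : MvPolynomial.eval y Q
        = s ^ N * ∑ α, e α * bernFn d N α.1 (fun j => y j.castSucc / s) := by
      rw [hQ, map_sum, Finset.mul_sum]
      refine Finset.sum_congr rfl fun α _ => ?_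
      rw [MvPolynomial.eval_monomial, Finsupp.prod_fintype _ _ (fun _ => pow_zero _)]
      have h3 : ∏ j, y j ^ α.1 j
          = s ^ N * ∏ j, bary d (fun j => y j.castSucc / s) j ^ α.1 j := by
        conv_lhs => enter [2, j]; rw [hb j, mul_pow]
        rw [Finset.prod_mul_distrib, Finset.prod_pow_eq_pow_sum, α.2]
      simp only [Finsupp.equivFunOnFinite_symm_apply_apply]
      rw [h3, bernFn]
      ring
    rw [h2, h1, mul_zero, map_zero]
  ext α
  have h4 : MvPolynomial.coeff (Finsupp.equivFunOnFinite.symm α.1) Q = 0 := by rw [hQ0]; simp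
  rw [hQ, MvPolynomial.coeff_sum, Finset.sum_eq_single α] at h4
  · rw [MvPolynomial.coeff_monomial, if_pos rfl] at h4
    have : ((N.factorial : ℝ) / ∏ j, ((α.1 j).factorial : ℝ)) ≠ 0 := by positivity
    exact (mul_eq_zero.1 h4).resolve_right this
  · intro b _ hb
    rw [MvPolynomial.coeff_monomial, if_neg]
    intro hh
    exact hb (Subtype.ext (Finsupp.equivFunOnFinite.symm.injective hh))
  · simp

/-- Eigenvectors of the Bernstein mass matrix: let `d ≥ 1`, `N ≥ 0`, `0 ≤ i ≤ N`.
If `p : ℝ^d → ℝ` is a polynomial function of total degree at most `i` which is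
`L²(T_d)`-orthogonal to every polynomial of total degree at most `i−1` (i.e. `< i`),
and `c` is a vector of Bernstein coefficients for `p` of degree `N`, then
`M^N c = λ^N_i c` with `λ^N_i = (N!)² / ((N+i+d)!(N−i)!)`. -/
theorem stmt6 (d N i : ℕ) (hd : 1 ≤ d) (hi : i ≤ N)
    (p : (Fin d → ℝ) → ℝ)
    (hp : ∃ P : MvPolynomial (Fin d) ℝ, P.totalDegree ≤ i ∧
      ∀ x, MvPolynomial.eval x P = p x)
    (horth : ∀ q : MvPolynomial (Fin d) ℝ, q.totalDegree < i →
      ∫ x in unitSimplex d, p x * MvPolynomial.eval x q = 0)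
    (c : {α : Fin (d + 1) → ℕ // ∑ j, α j = N} → ℝ)
    (hc : ∀ x, p x = ∑ α : {α : Fin (d + 1) → ℕ // ∑ j, α j = N}, c α * bernFn d N α.1 x) :
    (massMatrix d N).mulVec c
      = ((N.factorial : ℝ) ^ 2
          / (((N + i + d).factorial : ℝ) * ((N - i).factorial : ℝ))) • c := by
  obtain ⟨P, hPd, hPe⟩ := hp
  have hMc : ∀ α : {α : Fin (d + 1) → ℕ // ∑ j, α j = N},
      (massMatrix d N).mulVec c α = ipl (bernPoly d N α.1) P := by
    intro α
    have hP : P = ∑ β : {α : Fin (d + 1) → ℕ // ∑ j, α j = N}, c β • bernPoly d N β.1 := by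
      apply MvPolynomial.funext
      intro x
      rw [hPe, hc]
      simp [eval_bernPoly]
    rw [hP, map_sum]
    simp only [Matrix.mulVec, dotProduct]
    refine Finset.sum_congr rfl fun β _ => ?_
    rw [map_smul, ipl_comm, ipl_def, smul_eq_mul, mul_comm]
    simp only [eval_bernPoly, massMatrix]
  have horth' : ∀ q : MvPolynomial (Fin d) ℝ, q.totalDegree < i → ipl P q = 0 := by
    intro q hq
    rw [ipl_comm, ipl_def]
    simpa only [hPe] using horth q hq
  set R := durr d N P - lam d N i • P with hR
  have hRlow : R ∈ lowDeg d i := durr_lead hi P hPd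
  have hRR : ipl R R = 0 := by
    conv_lhs => rw [hR]
    rw [← hR, map_sub, map_smul, durr_adj, ipl_low P horth' (durr_low hRlow), ipl_comm,
      ipl_low P horth' hRlow]
    simp
  have he := bern_indep ((massMatrix d N).mulVec c - lam d N i • c) (by
    intro x hx hx1
    have h0 := eq_zero_of_ipl_self R hRR x hx hx1
    rw [hR, durr_apply] at h0
    simp only [map_sub, map_sum, MvPolynomial.smul_eval, eval_bernPoly, hPe, hc,
      Finset.mul_sum] at h0
    rw [← h0, ← Finset.sum_sub_distrib]
    refine Finset.sum_congr rfl fun α _ => ?_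
    simp only [Pi.sub_apply, Pi.smul_apply, hMc, smul_eq_mul]
    ring)
  exact sub_eq_zero.1 he
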